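/- Let γ ∈ (1/2,1], α ∈ ℝ and let w : [0,1] → ℝ^d be continuous with K^w_{α,γ} < ∞. There is a constant C depending only on α, γ, d such that: (i) for every Lipschitz path θ : [0,1] → ℝ^d one has K^{w+θ}_{α+γ,γ} ≤ C K^w_{α,γ} (1 + ‖θ‖_{Lip}^γ); and (ii) for every γ-Hölder path θ : [0,1] → ℝ^d one has K^{w+θ}_{α+1,γ} ≤ C K^w_{α,γ} (1 + ‖θ‖_{γ,[0,1]}). -/

import Mathlib

open MeasureTheory Filter Topology
open scoped ENNReal NNReal

noncomputable section

abbrev Euc (d : ℕ) : Type := EuclideanSpace ℝ (Fin d)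

/-- `Y^w_{s,t}(ω,ξ) = ∫_s^t exp(i ξ·w_u + i ω u) du`. -/
def Yint {d : ℕ} (w : ℝ → Euc d) (s t ω : ℝ) (ξ : Euc d) : ℂ :=
  ∫ u in s..t, Complex.exp (Complex.I * Complex.ofReal (inner ℝ ξ (w u) + ω * u))

/-- The averaging constant `K^w_{α,γ}`. -/
def avgK {d : ℕ} (w : ℝ → Euc d) (α γ : ℝ) : ℝ≥0∞ :=
  ⨆ (s : ℝ) (t : ℝ) (_ : 0 ≤ s) (_ : s < t) (_ : t ≤ 1) (ω : ℝ) (ξ : Euc d),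
    ENNReal.ofReal (‖Yint w s t ω ξ‖ /
      ((1 + ‖ξ‖) ^ α * (1 + Real.sqrt (Real.log (1 + |ω|))) * (t - s) ^ γ))

/-- The norm `N_α` of a space-time vector field given through its Fourier transform `bhat`. -/
def FLnorm (d : ℕ) (α : ℝ) (bhat : ℝ × Euc d → Fin d → ℂ) : ℝ≥0∞ :=
  ∫⁻ p : ℝ × Euc d, ENNReal.ofReal (‖bhat p‖ * (1 + ‖p.2‖) ^ α *
    (1 + Real.sqrt (Real.log (1 + |p.1|))))

/-- The vector field `b(t,x)` recovered from its space-time Fourier transform. -/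
def fieldOf {d : ℕ} (bhat : ℝ × Euc d → Fin d → ℂ) (t : ℝ) (x : Euc d) : Euc d :=
  (EuclideanSpace.equiv (Fin d) ℝ).symm fun i =>
    ∫ p : ℝ × Euc d, (bhat p i * Complex.exp (Complex.I * Complex.ofReal (p.1 * t + inner ℝ p.2 x))).re

/-- The averaged vector field `σ^w_{[s,t]} b`, defined through the Fourier representation. -/
def sigmaAvg {d : ℕ} (w : ℝ → Euc d) (bhat : ℝ × Euc d → Fin d → ℂ) (s t : ℝ) (x : Euc d) :
    Euc d :=
  (EuclideanSpace.equiv (Fin d) ℝ).symm fun i =>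
    ∫ p : ℝ × Euc d, (bhat p i * Yint w s t p.1 p.2 *
      Complex.exp (Complex.I * Complex.ofReal (inner ℝ p.2 x))).re

/-- Partitions of the interval `[s,t]`. -/
structure RealPartition (s t : ℝ) where
  n : ℕ
  pts : ℕ → ℝ
  first : pts 0 = s
  last : pts n = t
  mono : ∀ i, i < n → pts i ≤ pts (i + 1)

/-- The mesh of the partition is smaller than `δ`. -/
def RealPartition.MeshLt {s t : ℝ} (P : RealPartition s t) (δ : ℝ) : Prop :=
  ∀ i, i < P.n → P.pts (i + 1) - P.pts i < δ

/-- Riemann sums `Σ_i (G_{t_{i+1}} - G_{t_i})(f_{t_i})` of the nonlinear Young integral. -/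
def RiemannSum {V W : Type*} [AddCommGroup W] (G : ℝ → V → W) (f : ℝ → V)
    {s t : ℝ} (P : RealPartition s t) : W :=
  ∑ i ∈ Finset.range P.n, (G (P.pts (i + 1)) (f (P.pts i)) - G (P.pts i) (f (P.pts i)))

/-- `L` is the nonlinear Young integral `∫_s^t G_{du}(f_u)`: the Riemann sums converge to `L`
as the mesh of the partition tends to `0`. -/
def HasYoungIntegral {V W : Type*} [NormedAddCommGroup W] (G : ℝ → V → W) (f : ℝ → V)
    (s t : ℝ) (L : W) : Prop :=
  ∀ ε > 0, ∃ δ > 0, ∀ P : RealPartition s t, P.MeshLt δ → ‖RiemannSum G f P - L‖ < ε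

/-- Riemann sums `Σ_i (σ^w_{[t_i,t_{i+1}]} b)(θ_{t_i})`. -/
def sigmaRiemannSum {d : ℕ} (w : ℝ → Euc d) (bhat : ℝ × Euc d → Fin d → ℂ)
    (θ : ℝ → Euc d) {s t : ℝ} (P : RealPartition s t) : Euc d :=
  ∑ i ∈ Finset.range P.n, sigmaAvg w bhat (P.pts i) (P.pts (i + 1)) (θ (P.pts i))

/-- `L = ∫_s^t (σ^w_{du} b)(θ_u)` as a limit of Riemann sums. -/
def HasSigmaIntegral {d : ℕ} (w : ℝ → Euc d) (bhat : ℝ × Euc d → Fin d → ℂ)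
    (θ : ℝ → Euc d) (s t : ℝ) (L : Euc d) : Prop :=
  ∀ ε > 0, ∃ δ > 0, ∀ P : RealPartition s t, P.MeshLt δ → ‖sigmaRiemannSum w bhat θ P - L‖ < ε

/-- `θ` solves the Young equation `θ_t = x₀ + ∫_0^t (σ^w_{du} b)(θ_u)` on `[0,1]`. -/
def SolvesSigmaYoung {d : ℕ} (w : ℝ → Euc d) (bhat : ℝ × Euc d → Fin d → ℂ)
    (x₀ : Euc d) (θ : ℝ → Euc d) : Prop :=
  θ 0 = x₀ ∧ ∀ t ∈ Set.Icc (0 : ℝ) 1, HasSigmaIntegral w bhat θ 0 t (θ t - x₀)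

/-- `γ`-Hölder continuity on `[0,1]`. -/
def HolderOnIcc {E : Type*} [NormedAddCommGroup E] (γ : ℝ) (f : ℝ → E) : Prop :=
  ∃ C : ℝ, ∀ s ∈ Set.Icc (0 : ℝ) 1, ∀ t ∈ Set.Icc (0 : ℝ) 1, ‖f t - f s‖ ≤ C * |t - s| ^ γ

/-- Covariance of the fractional Brownian motion of Hurst index `H`. -/
def fbmCov (H : ℝ) (s t : ℝ) : ℝ := (s ^ (2 * H) + t ^ (2 * H) - |t - s| ^ (2 * H)) / 2

/-- `W` is a `d`-dimensional fractional Brownian motion of Hurst parameter `H` with continuous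
sample paths: the coordinates are independent centered Gaussian processes with the fBm
covariance, expressed by asking every finite linear combination to be Gaussian. -/
def IsFBM {Ω : Type*} [MeasureSpace Ω] (d : ℕ) (H : ℝ) (W : Ω → ℝ → Euc d) : Prop :=
  (∀ ω, ContinuousOn (W ω) (Set.Icc 0 1)) ∧
  (∀ t, Measurable fun ω => W ω t) ∧
  (∀ ω, W ω 0 = 0) ∧
  ∀ (n : ℕ) (c : Fin n → ℝ) (t : Fin n → ℝ) (j : Fin n → Fin d),
    (∀ k, t k ∈ Set.Icc (0 : ℝ) 1) →
    Measure.map (fun ω => ∑ k, c k * W ω (t k) (j k)) (volume : Measure Ω) =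
      ProbabilityTheory.gaussianReal 0
        (Real.toNNReal (∑ k, ∑ l, c k * c l *
          (if j k = j l then fbmCov H (t k) (t l) else 0)))

/-- `R^w_λ = (∫_0^1 exp(λ |w_u|²) du)^{1/λ}`. -/
def Rconst {d : ℕ} (lam : ℝ) (w : ℝ → Euc d) : ℝ≥0∞ :=
  (∫⁻ u in Set.Icc (0 : ℝ) 1, ENNReal.ofReal (Real.exp (lam * ‖w u‖ ^ 2))) ^ (1 / lam)

/-- `S^w_λ`. -/
def Sconst {d : ℕ} (H lam : ℝ) (w : ℝ → Euc d) : ℝ≥0∞ :=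
  (∑' n : ℕ, ∑' m : ℕ, ∑ k ∈ Finset.range (2 ^ n), ∑' q : ℤ × (Fin d → ℤ),
    ENNReal.ofReal (
      (2 : ℝ) ^ (-(2 * (n : ℝ)) - (m : ℝ) * ((d : ℝ) + 2)) *
      (1 + |(q.1 : ℝ) / 2 ^ m|) ^ (-(2 : ℝ)) *
      (1 + ‖(EuclideanSpace.equiv (Fin d) ℝ).symm (fun i => (q.2 i : ℝ) / 2 ^ m)‖) ^
        (-((d : ℝ) + 1)) *
      Real.exp (lam * 2 ^ n *
        (1 + ‖(EuclideanSpace.equiv (Fin d) ℝ).symm (fun i => (q.2 i : ℝ) / 2 ^ m)‖) ^ (1 / H) *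
        ‖Yint w ((k : ℝ) / 2 ^ n) (((k : ℝ) + 1) / 2 ^ n) ((q.1 : ℝ) / 2 ^ m)
          ((EuclideanSpace.equiv (Fin d) ℝ).symm (fun i => (q.2 i : ℝ) / 2 ^ m))‖ ^ 2))) ^
  (1 / lam)

/-- `Q^w_λ = √(log S^w_λ) + √(log R^w_λ)`. -/
def Qconst {d : ℕ} (H lam : ℝ) (w : ℝ → Euc d) : ℝ :=
  Real.sqrt (Real.log (Sconst H lam w).toReal) + Real.sqrt (Real.log (Rconst lam w).toReal)

/-- The constant of the sewing estimate for exponent `2γ > 1`. -/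
def sewConst (γ : ℝ) : ℝ := (1 / 2 : ℝ) ^ (2 * γ) / (1 - 2 * (1 / 2 : ℝ) ^ (2 * γ))

lemma half_rpow_lt {γ : ℝ} (hγ : 1 / 2 < γ) : (1 / 2 : ℝ) ^ (2 * γ) < 1 / 2 := by
  have h := Real.rpow_lt_rpow_of_exponent_gt (x := (1 / 2 : ℝ)) (by norm_num) (by norm_num)
    (show (1 : ℝ) < 2 * γ by linarith)
  simpa using h

lemma sewConst_nonneg {γ : ℝ} (hγ : 1 / 2 < γ) : 0 ≤ sewConst γ := by
  have h := half_rpow_lt hγ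
  exact div_nonneg (by positivity) (by linarith)

lemma sewConst_eq {γ : ℝ} (hγ : 1 / 2 < γ) :
    sewConst γ = 2 * (1 / 2 : ℝ) ^ (2 * γ) * sewConst γ + (1 / 2 : ℝ) ^ (2 * γ) := by
  have h := half_rpow_lt hγ
  have h' : 1 - 2 * (1 / 2 : ℝ) ^ (2 * γ) ≠ 0 := by linarith
  unfold sewConst
  field_simp
  ring

/-- Sewing estimate by repeated bisection. -/
lemma le_of_midpoint_subadditive {γ B E : ℝ} (hγ : 1 / 2 < γ) (hE : 0 ≤ E) {D : ℝ → ℝ → ℝ}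
    (hmid : ∀ a b, 0 ≤ a → a < b → b ≤ 1 →
      D a b ≤ D a ((a + b) / 2) + D ((a + b) / 2) b + E * ((b - a) / 2) ^ (2 * γ))
    (hD : ∀ a b, 0 ≤ a → a < b → b ≤ 1 → D a b ≤ B * (b - a) ^ (1 + γ))
    {a b : ℝ} (ha : 0 ≤ a) (hab : a < b) (hb : b ≤ 1) :
    D a b ≤ sewConst γ * E * (b - a) ^ (2 * γ) := by
  have key : ∀ n : ℕ, ∀ a b, 0 ≤ a → a < b → b ≤ 1 →
      D a b ≤ B * (b - a) ^ (1 + γ) * ((1 / 2 : ℝ) ^ γ) ^ n +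
        sewConst γ * E * (b - a) ^ (2 * γ) := by
    intro n
    induction n with
    | zero =>
      intro a b ha hab hb
      have h0 : 0 ≤ sewConst γ * E * (b - a) ^ (2 * γ) :=
        mul_nonneg (mul_nonneg (sewConst_nonneg hγ) hE) (Real.rpow_nonneg (by linarith) _)
      simpa using (hD a b ha hab hb).trans (le_add_of_nonneg_right h0)
    | succ n ih =>
      intro a b ha hab hb
      have h1 := ih a ((a + b) / 2) ha (by linarith) (by linarith)
      have h2 := ih ((a + b) / 2) b (by linarith) (by linarith) hb
      have h3 := hmid a b ha hab hb
      have e1 : (a + b) / 2 - a = (b - a) * (1 / 2) := by ring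
      have e2 : b - (a + b) / 2 = (b - a) * (1 / 2) := by ring
      have e3 : (b - a) / 2 = (b - a) * (1 / 2) := by ring
      have hba : 0 ≤ b - a := by linarith
      have e4 : (1 / 2 : ℝ) ^ (1 + γ) = 1 / 2 * (1 / 2 : ℝ) ^ γ := by
        rw [Real.rpow_add (by norm_num), Real.rpow_one]
      rw [e1, Real.mul_rpow hba (by norm_num), Real.mul_rpow hba (by norm_num), e4] at h1
      rw [e2, Real.mul_rpow hba (by norm_num), Real.mul_rpow hba (by norm_num), e4] at h2
      rw [e3, Real.mul_rpow hba (by norm_num)] at h3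
      have hc := sewConst_eq hγ
      refine h3.trans ((add_le_add_left (add_le_add h1 h2) _).trans (le_of_eq ?_))
      linear_combination (-E * (b - a) ^ (2 * γ)) * hc
  have hlim : Tendsto (fun n : ℕ => B * (b - a) ^ (1 + γ) * ((1 / 2 : ℝ) ^ γ) ^ n +
        sewConst γ * E * (b - a) ^ (2 * γ)) atTop
      (𝓝 (B * (b - a) ^ (1 + γ) * 0 + sewConst γ * E * (b - a) ^ (2 * γ))) := by
    have t1 := tendsto_pow_atTop_nhds_zero_of_lt_one (r := (1 / 2 : ℝ) ^ γ) (by positivity)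
      (Real.rpow_lt_one (by norm_num) (by norm_num) (by linarith))
    exact (t1.const_mul _).add_const _
  simpa using ge_of_tendsto' hlim fun n => key n a b ha hab hb

lemma continuousOn_of_norm_sub_le_rpow {E : Type*} [NormedAddCommGroup E] {γ B : ℝ} (hγ : 0 < γ)
    {g : ℝ → E} {S : Set ℝ} (hg : ∀ u ∈ S, ∀ v ∈ S, ‖g v - g u‖ ≤ B * |v - u| ^ γ) :
    ContinuousOn g S := by
  intro u hu
  rw [ContinuousWithinAt, tendsto_iff_norm_sub_tendsto_zero]
  have hc : Continuous fun v : ℝ => B * |v - u| ^ γ :=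
    continuous_const.mul ((continuous_id.sub continuous_const).abs.rpow_const fun _ => .inr hγ.le)
  have h0 : Tendsto (fun v : ℝ => B * |v - u| ^ γ) (𝓝[S] u) (𝓝 0) := by
    have := (hc.tendsto u).mono_left (nhdsWithin_le_nhds (s := S))
    simpa [Real.zero_rpow hγ.ne'] using this
  refine squeeze_zero' (Eventually.of_forall fun _ => norm_nonneg _) ?_ h0
  filter_upwards [self_mem_nhdsWithin] with v hv using hg u hu v hv

/-- Young's estimate for `∫ f g`, where the primitive of `f` and the path `g` are `γ`-Hölder
with `γ > 1/2`. -/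
lemma norm_integral_mul_le_young {γ A B : ℝ} (hγ : 1 / 2 < γ) (hA : 0 ≤ A) (hB : 0 ≤ B)
    {f g : ℝ → ℂ} (hfc : ContinuousOn f (Set.Icc 0 1))
    (hf1 : ∀ u, ‖f u‖ ≤ 1) (hg1 : ∀ u, ‖g u‖ ≤ 1)
    (hf : ∀ a b, 0 ≤ a → a < b → b ≤ 1 → ‖∫ u in a..b, f u‖ ≤ A * (b - a) ^ γ)
    (hg : ∀ u ∈ Set.Icc (0 : ℝ) 1, ∀ v ∈ Set.Icc (0 : ℝ) 1, ‖g v - g u‖ ≤ B * |v - u| ^ γ)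
    {s t : ℝ} (hs : 0 ≤ s) (hst : s < t) (ht : t ≤ 1) :
    ‖∫ u in s..t, f u * g u‖ ≤ A * (t - s) ^ γ * (1 + sewConst γ * B) := by
  have hgc : ContinuousOn g (Set.Icc 0 1) := continuousOn_of_norm_sub_le_rpow (by linarith) hg
  have int_of : ∀ {h : ℝ → ℂ}, ContinuousOn h (Set.Icc 0 1) → ∀ a b, 0 ≤ a → a ≤ b → b ≤ 1 →
      IntervalIntegrable h volume a b := fun hh a b ha hab hb =>
    (hh.mono (Set.Icc_subset_Icc ha hb)).intervalIntegrable_of_Icc hab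
  have hfgc : ContinuousOn (fun u => f u * g u) (Set.Icc 0 1) := hfc.mul hgc
  have hsub : ∀ (x : ℂ) (a b : ℝ), 0 ≤ a → a ≤ b → b ≤ 1 →
      ∫ u in a..b, f u * (g u - x) = (∫ u in a..b, f u * g u) - (∫ u in a..b, f u) * x := by
    intro x a b ha hab hb
    simp_rw [mul_sub]
    rw [intervalIntegral.integral_sub (int_of hfgc a b ha hab hb)
      ((int_of hfc a b ha hab hb).mul_const x), intervalIntegral.integral_mul_const]
  have hsew := le_of_midpoint_subadditive (B := B) hγ (mul_nonneg hA hB)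
    (D := fun a b => ‖∫ u in a..b, f u * (g u - g a)‖) (E := A * B) (a := s) (b := t) ?_ ?_
    hs hst ht
  · have hts : (t - s) ^ γ ≤ 1 := Real.rpow_le_one (by linarith) (by linarith) (by linarith)
    have hp : 0 ≤ (t - s) ^ γ := Real.rpow_nonneg (by linarith) _
    have e : (t - s) ^ (2 * γ) = (t - s) ^ γ * (t - s) ^ γ := by
      rw [two_mul, Real.rpow_add (by linarith)]
    have h1 : ∫ u in s..t, f u * g u =
        (∫ u in s..t, f u * (g u - g s)) + (∫ u in s..t, f u) * g s := by
      rw [hsub _ s t hs hst.le ht]; ring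
    have h2 : ‖(∫ u in s..t, f u) * g s‖ ≤ A * (t - s) ^ γ := by
      rw [norm_mul]
      exact (mul_le_of_le_one_right (norm_nonneg _) (hg1 s)).trans (hf s t hs hst ht)
    have h3 : sewConst γ * (A * B) * (t - s) ^ (2 * γ) ≤
        A * (t - s) ^ γ * (sewConst γ * B) := by
      rw [e]
      have h0 : 0 ≤ A * (t - s) ^ γ * (sewConst γ * B) := by
        have := sewConst_nonneg hγ
        positivity
      calc _ = A * (t - s) ^ γ * (sewConst γ * B) * (t - s) ^ γ := by ring
        _ ≤ _ := mul_le_of_le_one_right h0 hts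
    rw [h1]
    refine (norm_add_le _ _).trans ((add_le_add (hsew.trans h3) h2).trans (le_of_eq ?_))
    ring
  · intro a b ha hab hb
    set m := (a + b) / 2 with hm
    have ham : a < m := by linarith
    have hmb : m < b := by linarith
    have hm0 : 0 ≤ m := by linarith
    have hm1 : m ≤ 1 := by linarith
    have hsplit : ∫ u in a..b, f u * (g u - g a) =
        (∫ u in a..m, f u * (g u - g a)) + (∫ u in m..b, f u * (g u - g m)) +
          (∫ u in m..b, f u) * (g m - g a) := by
      rw [hsub _ a b ha hab.le hb, hsub _ a m ha ham.le hm1, hsub _ m b hm0 hmb.le hb,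
        ← intervalIntegral.integral_add_adjacent_intervals (int_of hfgc a m ha ham.le hm1)
          (int_of hfgc m b hm0 hmb.le hb),
        ← intervalIntegral.integral_add_adjacent_intervals (int_of hfc a m ha ham.le hm1)
          (int_of hfc m b hm0 hmb.le hb)]
      ring
    have hrem : ‖(∫ u in m..b, f u) * (g m - g a)‖ ≤ A * B * ((b - a) / 2) ^ (2 * γ) := by
      have h1 := hf m b hm0 hmb hb
      have h2 := hg a ⟨ha, by linarith⟩ m ⟨hm0, hm1⟩
      rw [abs_of_pos (by linarith), show m - a = (b - a) / 2 by rw [hm]; ring] at h2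
      rw [show b - m = (b - a) / 2 by rw [hm]; ring] at h1
      have e : ((b - a) / 2) ^ (2 * γ) = ((b - a) / 2) ^ γ * ((b - a) / 2) ^ γ := by
        rw [two_mul, Real.rpow_add (by linarith)]
      rw [norm_mul, e]
      refine (mul_le_mul h1 h2 (norm_nonneg _) ((norm_nonneg _).trans h1)).trans (le_of_eq ?_)
      ring
    rw [hsplit]
    exact (norm_add_le _ _).trans (add_le_add (norm_add_le _ _) hrem)
  · intro a b ha hab hb
    have hba : 0 < b - a := by linarith
    have h : ∀ u ∈ Set.uIoc a b, ‖f u * (g u - g a)‖ ≤ B * (b - a) ^ γ := by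
      intro u hu
      rw [Set.uIoc_of_le hab.le] at hu
      have h2 := hg a ⟨ha, by linarith⟩ u ⟨by linarith [hu.1], hu.2.trans hb⟩
      rw [abs_of_pos (by linarith [hu.1])] at h2
      rw [norm_mul]
      refine (mul_le_of_le_one_left (norm_nonneg _) (hf1 u)).trans (h2.trans ?_)
      have hu1 : 0 ≤ u - a := by linarith [hu.1]
      have hu2 : u - a ≤ b - a := by linarith [hu.2]
      gcongr
    refine (intervalIntegral.norm_integral_le_of_norm_le_const h).trans (le_of_eq ?_)
    rw [abs_of_pos hba, Real.rpow_add hba, Real.rpow_one]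
    ring

lemma norm_Yint_le_avgK {d : ℕ} {w : ℝ → Euc d} {α γ : ℝ} (hK : avgK w α γ < ⊤) {s t : ℝ}
    (hs : 0 ≤ s) (hst : s < t) (ht : t ≤ 1) (ω : ℝ) (ξ : Euc d) :
    ‖Yint w s t ω ξ‖ ≤ (avgK w α γ).toReal * ((1 + ‖ξ‖) ^ α *
      (1 + Real.sqrt (Real.log (1 + |ω|))) * (t - s) ^ γ) := by
  have hts : 0 < t - s := by linarith
  have h : ENNReal.ofReal (‖Yint w s t ω ξ‖ /
      ((1 + ‖ξ‖) ^ α * (1 + Real.sqrt (Real.log (1 + |ω|))) * (t - s) ^ γ)) ≤ avgK w α γ := by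
    unfold avgK
    exact le_iSup_of_le s <| le_iSup_of_le t <| le_iSup_of_le hs <| le_iSup_of_le hst <|
      le_iSup_of_le ht <| le_iSup_of_le ω <| le_iSup_of_le ξ le_rfl
  rw [ENNReal.ofReal_le_iff_le_toReal hK.ne] at h
  exact (div_le_iff₀ (by positivity)).1 h

/-- If `u ↦ exp(i ξ·θ_u)` is `γ`-Hölder with constant `B ξ`, then perturbing by `θ` costs the
factor `1 + c B ξ`. -/
lemma avgK_add_le {d : ℕ} {α β γ M : ℝ} (hγ : 1 / 2 < γ) (hM : 0 ≤ M) {w θ : ℝ → Euc d}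
    (hw : ContinuousOn w (Set.Icc 0 1)) (hK : avgK w α γ < ⊤) {B : Euc d → ℝ}
    (hB0 : ∀ ξ, 0 ≤ B ξ)
    (hB : ∀ ξ, 1 + sewConst γ * B ξ ≤ M * (1 + ‖ξ‖) ^ β)
    (hθ : ∀ ξ, ∀ u ∈ Set.Icc (0 : ℝ) 1, ∀ v ∈ Set.Icc (0 : ℝ) 1,
      ‖Complex.exp (Complex.I * Complex.ofReal (inner ℝ ξ (θ v))) -
        Complex.exp (Complex.I * Complex.ofReal (inner ℝ ξ (θ u)))‖ ≤ B ξ * |v - u| ^ γ) :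
    avgK (fun u => w u + θ u) (α + β) γ ≤ ENNReal.ofReal M * avgK w α γ := by
  rw [avgK]
  refine iSup_le fun s => iSup_le fun t => iSup_le fun hs => iSup_le fun hst => iSup_le fun ht =>
    iSup_le fun ω => iSup_le fun ξ => ?_
  rw [← ENNReal.ofReal_toReal hK.ne, ← ENNReal.ofReal_mul hM]
  apply ENNReal.ofReal_le_ofReal
  have hts : 0 < t - s := by linarith
  rw [div_le_iff₀ (by positivity)]
  set K := (avgK w α γ).toReal
  have hK0 : 0 ≤ K := ENNReal.toReal_nonneg
  set Λ := 1 + Real.sqrt (Real.log (1 + |ω|))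
  have hΛ0 : 0 ≤ Λ := by positivity
  have hYoung := norm_integral_mul_le_young (A := K * ((1 + ‖ξ‖) ^ α * Λ)) (B := B ξ) hγ
    (by positivity) (hB0 ξ)
    (f := fun u => Complex.exp (Complex.I * Complex.ofReal (inner ℝ ξ (w u) + ω * u)))
    (g := fun u => Complex.exp (Complex.I * Complex.ofReal (inner ℝ ξ (θ u))))
    (by fun_prop) (fun u => (Complex.norm_exp_I_mul_ofReal _).le)
    (fun u => (Complex.norm_exp_I_mul_ofReal _).le)
    (fun a b ha hab hb => (norm_Yint_le_avgK hK ha hab hb ω ξ).trans (le_of_eq (by ring)))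
    (hθ ξ) hs hst ht
  have hY : Yint (fun u => w u + θ u) s t ω ξ = ∫ u in s..t,
      Complex.exp (Complex.I * Complex.ofReal (inner ℝ ξ (w u) + ω * u)) *
        Complex.exp (Complex.I * Complex.ofReal (inner ℝ ξ (θ u))) := by
    unfold Yint
    congr 1 with u
    rw [← Complex.exp_add, inner_add_right]
    push_cast
    ring_nf
  rw [hY, Real.rpow_add (by positivity)]
  refine hYoung.trans ((mul_le_mul_of_nonneg_left (hB ξ) (by positivity)).trans (le_of_eq ?_))
  ring

lemma norm_exp_I_mul_sub_le (x y : ℝ) :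
    ‖Complex.exp (Complex.I * x) - Complex.exp (Complex.I * y)‖ ≤ |x - y| := by
  have h : Complex.exp (Complex.I * x) - Complex.exp (Complex.I * y) =
      Complex.exp (Complex.I * y) * (Complex.exp (Complex.I * ((x - y : ℝ) : ℂ)) - 1) := by
    rw [mul_sub, ← Complex.exp_add]
    push_cast
    ring_nf
  rw [h, norm_mul, Complex.norm_exp_I_mul_ofReal, one_mul]
  exact Real.norm_exp_I_mul_ofReal_sub_one_le

lemma norm_exp_inner_sub_le {d : ℕ} (ξ x y : Euc d) :
    ‖Complex.exp (Complex.I * Complex.ofReal (inner ℝ ξ x)) -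
      Complex.exp (Complex.I * Complex.ofReal (inner ℝ ξ y))‖ ≤ ‖ξ‖ * ‖x - y‖ := by
  refine (norm_exp_I_mul_sub_le _ _).trans ?_
  rw [← inner_sub_right]
  exact abs_real_inner_le_norm _ _

lemma norm_exp_I_mul_sub_le_two_mul_rpow {γ x y z : ℝ} (hγ : 0 ≤ γ) (hγ1 : γ ≤ 1) (hz : 0 ≤ z)
    (h : ‖Complex.exp (Complex.I * x) - Complex.exp (Complex.I * y)‖ ≤ z) :
    ‖Complex.exp (Complex.I * x) - Complex.exp (Complex.I * y)‖ ≤ 2 * z ^ γ := by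
  rcases le_total z 1 with hz1 | hz1
  · have := Real.rpow_le_rpow_of_exponent_ge' hz hz1 hγ hγ1
    rw [Real.rpow_one] at this
    linarith [Real.rpow_nonneg hz γ]
  · have h1 := Real.one_le_rpow hz1 hγ
    refine (norm_sub_le _ _).trans ?_
    rw [Complex.norm_exp_I_mul_ofReal, Complex.norm_exp_I_mul_ofReal]
    linarith

/-- Behaviour of the averaging constant under Hölder perturbations:
`K^{w+θ}_{α+γ,γ} ≤ C K^w_{α,γ}(1+‖θ‖_{Lip}^γ)` for Lipschitz `θ` and
`K^{w+θ}_{α+1,γ} ≤ C K^w_{α,γ}(1+‖θ‖_γ)` for `γ`-Hölder `θ`, with `C = C(α,γ,d)`. -/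
theorem statement7 (d : ℕ) (α γ : ℝ) (hγ : 1 / 2 < γ) (hγ1 : γ ≤ 1) :
    ∃ C : ℝ, 0 < C ∧ ∀ w : ℝ → Euc d, ContinuousOn w (Set.Icc 0 1) → avgK w α γ < ⊤ →
      (∀ (θ : ℝ → Euc d) (Lθ : ℝ), 0 ≤ Lθ →
        (∀ s ∈ Set.Icc (0 : ℝ) 1, ∀ t ∈ Set.Icc (0 : ℝ) 1, ‖θ t - θ s‖ ≤ Lθ * |t - s|) →
        avgK (fun u => w u + θ u) (α + γ) γ ≤
          ENNReal.ofReal (C * (1 + Lθ ^ γ)) * avgK w α γ) ∧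
      (∀ (θ : ℝ → Euc d) (Cθ : ℝ), 0 ≤ Cθ →
        (∀ s ∈ Set.Icc (0 : ℝ) 1, ∀ t ∈ Set.Icc (0 : ℝ) 1, ‖θ t - θ s‖ ≤ Cθ * |t - s| ^ γ) →
        avgK (fun u => w u + θ u) (α + 1) γ ≤
          ENNReal.ofReal (C * (1 + Cθ)) * avgK w α γ) := by
  have hc := sewConst_nonneg hγ
  have hγ0 : 0 ≤ γ := by linarith
  refine ⟨1 + 2 * sewConst γ, by positivity, fun w hw hK => ⟨fun θ L hL hθ => ?_,
    fun θ H hH hθ => ?_⟩⟩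
  · refine avgK_add_le hγ (by positivity) hw hK (B := fun ξ => 2 * (‖ξ‖ * L) ^ γ)
      (fun ξ => by positivity) (fun ξ => ?_) (fun ξ u hu v hv => ?_)
    · have h1 : (‖ξ‖ * L) ^ γ ≤ L ^ γ * (1 + ‖ξ‖) ^ γ := by
        rw [← Real.mul_rpow hL (by positivity)]
        exact Real.rpow_le_rpow (by positivity) (by nlinarith [norm_nonneg ξ]) hγ0
      have h2 : 1 ≤ (1 + ‖ξ‖) ^ γ := Real.one_le_rpow (by linarith [norm_nonneg ξ]) hγ0
      have h3 : 0 ≤ L ^ γ * (1 + ‖ξ‖) ^ γ := by positivity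
      nlinarith [mul_le_mul_of_nonneg_left h1 hc, mul_nonneg hc (zero_le_one.trans h2)]
    · have h := (norm_exp_inner_sub_le ξ (θ v) (θ u)).trans
        (mul_le_mul_of_nonneg_left (hθ u hu v hv) (norm_nonneg ξ))
      refine (norm_exp_I_mul_sub_le_two_mul_rpow hγ0 hγ1 (by positivity) h).trans (le_of_eq ?_)
      rw [← mul_assoc ‖ξ‖, Real.mul_rpow (by positivity) (abs_nonneg _), mul_assoc]
  · refine avgK_add_le hγ (by positivity) hw hK (B := fun ξ => ‖ξ‖ * H)
      (fun ξ => by positivity) (fun ξ => ?_) (fun ξ u hu v hv => ?_)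
    · rw [Real.rpow_one]
      have hξ := norm_nonneg ξ
      have := mul_nonneg hξ hH
      nlinarith [mul_nonneg hc this, mul_nonneg hc hξ, mul_nonneg hc hH]
    · rw [mul_assoc]
      exact (norm_exp_inner_sub_le ξ (θ v) (θ u)).trans
        (mul_le_mul_of_nonneg_left (hθ u hu v hv) (norm_nonneg ξ))
end
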